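/- Suppose the system is highly non-singular, and let 𝒜 be either ℤ ∩ [1,P] or the set 𝒜(P,R) of R-smooth numbers up to P, for some 2 ≤ R ≤ P. Then there is a constant C, depending only on the coefficients c_{ij}, the degrees, and u_1,…,u_t (but not on P or R), such that |I_{𝐮,𝐤,𝛍}(𝒜)| ≤ C · Π_{h=1}^{t} (J_{u_h, 𝐤_h}(𝒜))^{μ_h − μ_{h+1}} for all P ≥ 1. -/

import Mathlib

open MeasureTheory Filter Finset
open scoped Classical

noncomputable section

/-- `e(θ) = exp(2πiθ)`. -/
def eC (θ : ℝ) : ℂ := Complex.exp (2 * Real.pi * Complex.I * θ)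

/-- Index pairs `(l, n)` for the distinct exponents `k_{l,n}`. -/
abbrev KIdx (t : ℕ) (ν : Fin t → ℕ) := Σ l : Fin t, Fin (ν l)

/-- Equation indices `(l, n, m)`: the `μ_l` equations of exponent `k_{l,n}`
(the interval `𝓘_{l,n}`). -/
abbrev EqIdx (t : ℕ) (ν μ : Fin t → ℕ) := Σ l : Fin t, Fin (ν l) × Fin (μ l)

variable (t : ℕ) (ν μ : Fin t → ℕ) (k : (l : Fin t) → Fin (ν l) → ℕ)

/-- The degree `d_i` of equation `i`. -/
def deg (i : EqIdx t ν μ) : ℕ := k i.1 i.2.1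

/-- `μ_h` for `1 ≤ h ≤ t` (`1`-based), with the convention `μ_{t+1} = 0`. -/
def mu1 (h : ℕ) : ℕ := if hh : 1 ≤ h ∧ h ≤ t then μ ⟨h - 1, by omega⟩ else 0

/-- `ϖ_h = ν(1) + ⋯ + ν(h)`. -/
def varpi (h : ℕ) : ℕ := ∑ l : Fin t, if (l : ℕ) < h then ν l else 0

/-- `K_1 + ⋯ + K_h`. -/
def Ksum (h : ℕ) : ℕ := ∑ p : KIdx t ν, if (p.1 : ℕ) < h then k p.1 p.2 else 0

/-- The largest degree `k`. -/
def kmax : ℕ := Finset.univ.sup fun p : KIdx t ν => k p.1 p.2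

/-- The total degree `K = d_1 + ⋯ + d_r`. -/
def Ktot : ℕ := ∑ i : EqIdx t ν μ, deg t ν μ k i

/-- The grouping hypotheses: `t ≥ 1`, all `ν l ≥ 1`, the multiplicities are
positive and strictly decreasing `μ_1 > ⋯ > μ_t`, and the exponents `k_{l,n}`
are positive and pairwise distinct. -/
def GroupedDegrees : Prop :=
  0 < t ∧ (∀ l, 0 < ν l) ∧ (∀ l, 0 < μ l) ∧ StrictAnti μ ∧
    (∀ l n, 0 < k l n) ∧ Function.Injective fun p : KIdx t ν => k p.1 p.2

/-- `ℤ ∩ [1, P]` as a finite set. -/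
def completeFS (P : ℝ) : Finset ℕ := Finset.Icc 1 ⌊P⌋₊

/-- `𝒜(P,R)`: the `R`-smooth numbers up to `P`. -/
def smoothFS (P R : ℝ) : Finset ℕ :=
  (Finset.Icc 1 ⌊P⌋₊).filter fun n => ∀ p : ℕ, p.Prime → p ∣ n → (p : ℝ) ≤ R

/-- The exponential sum `f_{𝐤_h}(γ; 𝒜) = Σ_{x ∈ 𝒜} e(Σ_{l ≤ h, n} γ_{l,n} x^{k_{l,n}})`. -/
def fA (A : Finset ℕ) (h : ℕ) (γ : KIdx t ν → ℝ) : ℂ :=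
  ∑ x ∈ A, eC (∑ p : KIdx t ν, if (p.1 : ℕ) < h then γ p * (x : ℝ) ^ (k p.1 p.2) else 0)

/-- The mean value `J_{u,𝐤_h}(𝒜)` (the coordinates `γ_{l,n}` with `l > h` are
dummy variables over the probability box, so this agrees with the
`ϖ_h`-dimensional integral). -/
def JA (A : Finset ℕ) (u h : ℕ) : ℝ :=
  ∫ γ in Set.univ.pi fun _ : KIdx t ν => Set.Ico (0 : ℝ) 1, ‖fA t ν k A h γ‖ ^ (2 * u)

variable (s : ℕ) (c : EqIdx t ν μ → Fin s → ℤ)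

/-- The system `Σ_j c_{ij} x_j^{d_i} = 0` is highly non-singular: all coefficients
are nonzero and every `μ_l × μ_l` minor taken from the rows `𝓘_{l,n}` is nonzero. -/
def HighlyNonSingular : Prop :=
  (∀ i j, c i j ≠ 0) ∧
  ∀ (l : Fin t) (n : Fin (ν l)) (J : Fin (μ l) → Fin s), Function.Injective J →
    (Matrix.of fun m m' : Fin (μ l) => c ⟨l, (n, m)⟩ (J m')).det ≠ 0

/-- `x` is a solution of the system, with coordinates in a commutative ring. -/
def IsSol {A : Type*} [CommRing A] (x : Fin s → A) : Prop :=
  ∀ i, ∑ j, (c i j : A) * x j ^ deg t ν μ k i = 0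

/-- The Jacobian `(d_i c_{ij} x_j^{d_i - 1})` has full rank `r` at `x`. -/
def JacFullRank {A : Type*} [CommRing A] (x : Fin s → A) : Prop :=
  (Matrix.of fun (i : EqIdx t ν μ) (j : Fin s) =>
      (deg t ν μ k i : A) * (c i j : A) * x j ^ (deg t ν μ k i - 1)).rank
    = Fintype.card (EqIdx t ν μ)

/-- The generalized exponential sum `f_j(α; 𝒜) = Σ_{x ∈ 𝒜} e(Σ_{l,n} γ_{j,l,n} x^{k_{l,n}})`,
where `γ_{j,l,n} = Σ_{i ∈ 𝓘_{l,n}} c_{ij} α_i`. -/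
def fj (A : Finset ℕ) (α : EqIdx t ν μ → ℝ) (j : Fin s) : ℂ :=
  ∑ x ∈ A, eC (∑ i : EqIdx t ν μ, (c i j : ℝ) * α i * (x : ℝ) ^ deg t ν μ k i)

end

noncomputable section

/-- The mean value `I_{𝐮,𝐤,𝛍}(𝒜)`: the integral over the unit box `[0,1)^r`
of the product of the `f_j(α;𝒜)` over the blocks `B_{h,m}`. -/
def Iint (t : ℕ) (ν μ : Fin t → ℕ) (k : (l : Fin t) → Fin (ν l) → ℕ) (s : ℕ)
    (c : EqIdx t ν μ → Fin s → ℤ) (A : Finset ℕ) (B : ℕ × ℕ → Finset (Fin s)) : ℂ :=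
  ∫ α in Set.univ.pi fun _ : EqIdx t ν μ => Set.Ico (0 : ℝ) 1,
    ∏ h ∈ Finset.Icc 1 t, ∏ m ∈ Finset.Icc 1 (mu1 t μ h - mu1 t μ (h + 1)),
      ∏ j ∈ B (h, m), fj t ν μ k s c A α j

/-- The half-open unit box `[0,1)^ι`. -/
abbrev unitBox (ι : Type*) : Set (ι → ℝ) := Set.univ.pi fun _ => Set.Ico (0 : ℝ) 1

lemma eC_add (x y : ℝ) : eC (x + y) = eC x * eC y := by
  simp only [eC, ← Complex.exp_add]
  congr 1
  push_cast
  ring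

lemma eC_zero : eC 0 = 1 := by simp [eC]

lemma eC_sum {ι : Type*} (s : Finset ι) (f : ι → ℝ) : eC (∑ i ∈ s, f i) = ∏ i ∈ s, eC (f i) := by
  induction s using Finset.induction_on with
  | empty => simp [eC_zero]
  | insert a s ha ih => rw [Finset.sum_insert ha, Finset.prod_insert ha, eC_add, ih]

lemma conj_eC (x : ℝ) : (starRingEnd ℂ) (eC x) = eC (-x) := by
  simp only [eC, ← Complex.exp_conj]
  congr 1
  simp [Complex.conj_ofNat]

lemma norm_eC (x : ℝ) : ‖eC x‖ = 1 := by
  rw [eC, Complex.norm_exp]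
  simp

lemma continuous_eC : Continuous eC := by
  unfold eC
  fun_prop

lemma integral_eC_int (a : ℤ) :
    ∫ x in Set.Ico (0 : ℝ) 1, eC (a * x) = if a = 0 then 1 else 0 := by
  rw [MeasureTheory.integral_Ico_eq_integral_Ioc, ← intervalIntegral.integral_of_le zero_le_one]
  split_ifs with h
  · simp [h, eC_zero]
  · have hc : (2 * Real.pi * Complex.I * a : ℂ) ≠ 0 := by
      simp [Real.pi_ne_zero, h]
    have := integral_exp_mul_complex (a := 0) (b := 1) hc
    have h1 : Complex.exp (2 * Real.pi * Complex.I * a) = 1 := by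
      rw [mul_comm]
      exact Complex.exp_int_mul_two_pi_mul_I a
    simp only [eC]
    push_cast
    simp only [← mul_assoc]
    rw [this]
    simp [h1]

/-- Orthogonality of the characters of the torus. -/
lemma integral_unitBox_eC {ι : Type*} [Fintype ι] (a : ι → ℤ) :
    ∫ α in unitBox ι, eC (∑ i, (a i : ℝ) * α i) = if a = 0 then 1 else 0 := by
  simp only [eC_sum]
  rw [volume_pi, Measure.restrict_pi_pi,
    MeasureTheory.integral_fintype_prod_eq_prod (fun i (x : ℝ) => eC ((a i : ℝ) * x))]
  simp only [integral_eC_int]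
  rw [Finset.prod_ite_zero]
  simp [funext_iff]

lemma integrableOn_unitBox {ι E : Type*} [Fintype ι] [NormedAddCommGroup E]
    {f : (ι → ℝ) → E} (hf : Continuous f) : IntegrableOn f (unitBox ι) := by
  refine (hf.integrableOn_Icc (a := fun _ => 0) (b := fun _ => 1)).mono_set ?_
  rw [← Set.pi_univ_Icc]
  exact Set.pi_mono fun i _ => Set.Ico_subset_Icc_self

lemma continuous_eC_linear {ι : Type*} [Fintype ι] (a : ι → ℤ) :
    Continuous fun α : ι → ℝ => eC (∑ i, (a i : ℝ) * α i) :=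
  continuous_eC.comp (by fun_prop)

/-- The integral of a trigonometric polynomial counts the vanishing frequencies. -/
lemma integral_unitBox_sum_eC {ι W : Type*} [Fintype ι] [Fintype W] (v : W → ι → ℤ) :
    ∫ α in unitBox ι, ∑ w, eC (∑ i, (v w i : ℝ) * α i) =
      (#{w | v w = 0} : ℂ) := by
  rw [integral_finsetSum _ fun w _ => integrableOn_unitBox (continuous_eC_linear (v w))]
  simp only [integral_unitBox_eC]
  simp

/-- The number of terms of a given frequency in a non-negative trigonometric polynomial is at
most its mean value. -/
lemma card_fiber_le_integral {ι W : Type*} [Fintype ι] [Fintype W] (v : W → ι → ℤ)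
    (g : (ι → ℝ) → ℝ) (hg : ∀ α, 0 ≤ g α)
    (hgv : ∀ α, (g α : ℂ) = ∑ w, eC (∑ i, (v w i : ℝ) * α i)) (N : ι → ℤ) :
    (#{w | v w = N} : ℝ) ≤ ∫ α in unitBox ι, g α := by
  have h := integral_unitBox_sum_eC fun w => v w - N
  have e : ∀ α : ι → ℝ, ∑ w, eC (∑ i, ((v w - N) i : ℤ) * α i) =
      g α * eC (-∑ i, (N i : ℝ) * α i) := by
    intro α
    rw [hgv, Finset.sum_mul]
    refine Finset.sum_congr rfl fun w _ => ?_
    rw [← eC_add, ← sub_eq_add_neg, ← Finset.sum_sub_distrib]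
    congr 2
    ext i
    simp [sub_mul]
  simp only [e, sub_eq_zero] at h
  have h2 := norm_integral_le_integral_norm (μ := volume.restrict (unitBox ι))
    fun α => (g α : ℂ) * eC (-∑ i, (N i : ℝ) * α i)
  rw [h] at h2
  simpa [norm_eC, abs_of_nonneg (hg _)] using h2

/-- Expansion of an even moment of an exponential sum. -/
lemma norm_sum_eC_pow {ι : Type*} [Fintype ι] (A : Finset ℕ) (q : ι → ℕ → ℤ) (u : ℕ)
    (α : ι → ℝ) :
    ((‖∑ x ∈ A, eC (∑ i, (q i x : ℝ) * α i)‖ ^ (2 * u) : ℝ) : ℂ) =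
      ∑ w : (Fin u → A) × (Fin u → A),
        eC (∑ i, ((∑ a, (q i (w.1 a) - q i (w.2 a)) : ℤ) : ℝ) * α i) := by
  have h : ((‖∑ x ∈ A, eC (∑ i, (q i x : ℝ) * α i)‖ ^ (2 * u) : ℝ) : ℂ) =
      (∑ x : A, eC (∑ i, (q i x : ℝ) * α i)) ^ u *
        (∑ x : A, eC (-∑ i, (q i x : ℝ) * α i)) ^ u := by
    rw [pow_mul]
    push_cast
    rw [← Complex.mul_conj', mul_pow, ← Finset.sum_coe_sort A]
    simp only [map_sum, conj_eC]
  rw [h, Fintype.sum_pow, Fintype.sum_pow, Fintype.sum_mul_sum, Fintype.sum_prod_type]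
  refine Finset.sum_congr rfl fun x _ => Finset.sum_congr rfl fun y _ => ?_
  rw [← eC_sum, ← eC_sum, ← eC_add]
  congr 1
  rw [Finset.sum_neg_distrib, ← sub_eq_add_neg, ← Finset.sum_sub_distrib]
  push_cast
  simp only [Finset.sum_mul, ← Finset.sum_sub_distrib, ← sub_mul]
  rw [Finset.sum_comm]

/-- A set of tuples in which the fibre of each coordinate is determined by the coordinates of
strictly lower level is bounded by the product of the sizes of the fibres. -/
lemma card_le_prod_of_level {β : Type*} {Z V : β → Type*} [Finite β] [∀ b, Fintype (Z b)]
    (lev : β → ℕ) (σ : ∀ b, Z b → V b) (J : β → ℝ) (hJ0 : ∀ b, 0 ≤ J b)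
    (hJ : ∀ b N, (#{w | σ b w = N} : ℝ) ≤ J b) (T : Finset β) :
    ∀ S : Finset (∀ b, Z b),
      (∀ z ∈ S, ∀ z' ∈ S, ∀ b ∉ T, z b = z' b) →
      (∀ b ∈ T, ∀ z ∈ S, ∀ z' ∈ S, (∀ b', lev b' < lev b → z b' = z' b') →
        σ b (z b) = σ b (z' b)) →
      (#S : ℝ) ≤ ∏ b ∈ T, J b := by
  induction T using Finset.induction_on_min_value lev with
  | empty =>
    intro S hS _
    simp only [Finset.prod_empty, Nat.cast_le_one]
    exact Finset.card_le_one.2 fun z hz z' hz' =>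
      funext fun b => hS z hz z' hz' b (Finset.notMem_empty b)
  | insert a T ha hmin ih =>
    intro S hS hσ
    have hP : 0 ≤ ∏ b ∈ T, J b := Finset.prod_nonneg fun b _ => hJ0 b
    rcases S.eq_empty_or_nonempty with rfl | ⟨z₀, hz₀⟩
    · simpa using Finset.prod_nonneg fun b (_ : b ∈ insert a T) => hJ0 b
    have himg : (#(S.image fun z => z a) : ℝ) ≤ J a := by
      refine le_trans ?_ (hJ a (σ a (z₀ a)))
      gcongr
      intro w hw
      obtain ⟨z, hz, rfl⟩ := Finset.mem_image.1 hw
      simp only [Finset.mem_filter, Finset.mem_univ, true_and]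
      refine hσ a (Finset.mem_insert_self a T) z hz z₀ hz₀ fun b hb => hS z hz z₀ hz₀ b ?_
      rw [Finset.mem_insert, not_or]
      exact ⟨fun h => by simp [h] at hb, fun h => (hmin b h).not_gt hb⟩
    rw [Finset.prod_insert ha, Finset.card_eq_sum_card_image (fun z => z a) S]
    push_cast
    calc ∑ w ∈ S.image fun z => z a, (#{z ∈ S | z a = w} : ℝ)
        ≤ ∑ w ∈ S.image fun z => z a, ∏ b ∈ T, J b := by
          refine Finset.sum_le_sum fun w _ => ih _ ?_ ?_
          · simp only [Finset.mem_filter]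
            rintro z ⟨hz, hzw⟩ z' ⟨hz', hzw'⟩ b hb
            by_cases hba : b = a
            · rw [hba, hzw, hzw']
            · exact hS z hz z' hz' b (by simp [hba, hb])
          · simp only [Finset.mem_filter]
            rintro b hb z ⟨hz, -⟩ z' ⟨hz', -⟩ h
            exact hσ b (Finset.mem_insert_of_mem hb) z hz z' hz' h
      _ = #(S.image fun z => z a) * ∏ b ∈ T, J b := by simp
      _ ≤ J a * ∏ b ∈ T, J b := by gcongr

/-- The columns `p b` of level exceeding `l` form a non-singular square matrix in each block of
equations of multiplicity `μ l`. -/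
lemma HighlyNonSingular.eq_zero_of_sum_eq_zero {t : ℕ} {ν μ : Fin t → ℕ} {s : ℕ}
    {c : EqIdx t ν μ → Fin s → ℤ} (hns : HighlyNonSingular t ν μ s c) {β : Type*} [Fintype β]
    {p : β → Fin s} (hp : Function.Injective p) (l : Fin t) (n : Fin (ν l)) {H : Finset β}
    (hH : #H = μ l) {d : β → ℤ} (hd : ∀ b ∉ H, d b = 0)
    (h : ∀ m, ∑ b, c ⟨l, (n, m)⟩ (p b) * d b = 0) : d = 0 := by
  let e : Fin (μ l) ≃ H := (H.equivFinOfCardEq hH).symm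
  have hdet := hns.2 l n (fun m => p (e m))
    (hp.comp (Subtype.val_injective.comp e.injective))
  have hv : (fun m => d (e m)) = 0 := by
    refine Matrix.eq_zero_of_mulVec_eq_zero hdet (funext fun m => ?_)
    simp only [Matrix.mulVec, dotProduct, Matrix.of_apply, Pi.zero_apply]
    rw [← h m, e.sum_comp fun b : H => c ⟨l, (n, m)⟩ (p b) * d b,
      Finset.sum_coe_sort H fun b => c ⟨l, (n, m)⟩ (p b) * d b]
    exact Finset.sum_subset (Finset.subset_univ H) fun b _ hb => by simp [hd b hb]
  funext b
  by_cases hb : b ∈ H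
  · simpa using congrFun hv (e.symm ⟨b, hb⟩)
  · exact hd b hb

lemma JA_nonneg (t : ℕ) (ν : Fin t → ℕ) (k : (l : Fin t) → Fin (ν l) → ℕ) (A : Finset ℕ)
    (u h : ℕ) : 0 ≤ JA t ν k A u h :=
  integral_nonneg fun _ => by positivity

lemma continuous_fj (t : ℕ) (ν μ : Fin t → ℕ) (k : (l : Fin t) → Fin (ν l) → ℕ) (s : ℕ)
    (c : EqIdx t ν μ → Fin s → ℤ) (A : Finset ℕ) (j : Fin s) :
    Continuous fun α => fj t ν μ k s c A α j := by
  unfold fj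
  exact continuous_finsetSum _ fun x _ => continuous_eC.comp (by fun_prop)

/-- The mean value with one variable from each block, bounded by counting solutions level by
level. -/
lemma integral_prod_norm_fj_le {t : ℕ} {ν μ : Fin t → ℕ} (k : (l : Fin t) → Fin (ν l) → ℕ)
    {s : ℕ} {c : EqIdx t ν μ → Fin s → ℤ} (hns : HighlyNonSingular t ν μ s c)
    {β : Type*} [Fintype β] (lev u : β → ℕ) {p : β → Fin s} (hp : Function.Injective p)
    (hcard : ∀ l : Fin t, #{b | (l : ℕ) < lev b} = μ l) (A : Finset ℕ) :
    ∫ α in unitBox (EqIdx t ν μ), ∏ b, ‖fj t ν μ k s c A α (p b)‖ ^ (2 * u b) ≤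
      ∏ b, JA t ν k A (u b) (lev b) := by
  let Z : β → Type := fun b => (Fin (u b) → A) × (Fin (u b) → A)
  let q : EqIdx t ν μ → β → ℕ → ℤ := fun i b x => c i (p b) * (x : ℤ) ^ deg t ν μ k i
  let v : (∀ b, Z b) → EqIdx t ν μ → ℤ := fun z i =>
    ∑ b, ∑ a, (q i b ((z b).1 a) - q i b ((z b).2 a))
  let qJ : ℕ → KIdx t ν → ℕ → ℤ := fun h r x => if (r.1 : ℕ) < h then (x : ℤ) ^ k r.1 r.2 else 0
  let σ : ∀ b, Z b → KIdx t ν → ℤ := fun b w r =>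
    ∑ a, (qJ (lev b) r (w.1 a) - qJ (lev b) r (w.2 a))
  have hI : ∫ α in unitBox (EqIdx t ν μ), ∏ b, ‖fj t ν μ k s c A α (p b)‖ ^ (2 * u b) =
      (#{z | v z = 0} : ℝ) := by
    apply Complex.ofReal_injective
    rw [← integral_complex_ofReal, Complex.ofReal_natCast, ← integral_unitBox_sum_eC v]
    congr 1
    funext α
    have hf : ∀ b, ((‖fj t ν μ k s c A α (p b)‖ ^ (2 * u b) : ℝ) : ℂ) =
        ∑ w : Z b, eC (∑ i, ((∑ a, (q i b (w.1 a) - q i b (w.2 a)) : ℤ) : ℝ) * α i) := by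
      intro b
      rw [← norm_sum_eC_pow A (fun i => q i b) (u b) α, fj]
      simp only [q]
      push_cast
      simp only [mul_right_comm]
    rw [Complex.ofReal_prod, Finset.prod_congr rfl fun b _ => hf b, Fintype.prod_sum]
    refine Finset.sum_congr rfl fun z _ => ?_
    rw [← eC_sum, Finset.sum_comm]
    simp only [v, Int.cast_sum, Finset.sum_mul]
  rw [hI]
  refine card_le_prod_of_level lev σ _ (fun b => JA_nonneg ..) ?_ Finset.univ _ (by simp) ?_
  · intro b N
    have hg : ∀ γ, ((‖fA t ν k A (lev b) γ‖ ^ (2 * u b) : ℝ) : ℂ) =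
        ∑ w, eC (∑ r, (σ b w r : ℝ) * γ r) := by
      intro γ
      rw [← norm_sum_eC_pow A (qJ (lev b)) (u b) γ, fA]
      simp only [qJ]
      push_cast
      simp only [ite_mul, zero_mul, mul_comm (γ _)]
    have := card_fiber_le_integral (σ b) _ (fun γ => by positivity) hg N
    rw [JA]
    convert this
  · simp only [Finset.mem_filter, Finset.mem_univ, true_and]
    intro b _ z hz z' hz' hzz
    funext ⟨l, n⟩
    by_cases hl : (l : ℕ) < lev b
    · let D : (∀ b, Z b) → β → ℤ := fun z b =>
        ∑ a, ((((z b).1 a : ℕ) : ℤ) ^ k l n - (((z b).2 a : ℕ) : ℤ) ^ k l n)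
      have hD : ∀ z, v z = 0 → ∀ m, ∑ b, c ⟨l, (n, m)⟩ (p b) * D z b = 0 := by
        intro z hz m
        have := congrFun hz ⟨l, (n, m)⟩
        simp only [v, q, deg, ← mul_sub, ← Finset.mul_sum] at this
        exact this
      have h0 : D z - D z' = 0 := by
        refine hns.eq_zero_of_sum_eq_zero hp l n (hcard l) (fun b' hb' => ?_) fun m => ?_
        · have : z b' = z' b' := hzz b' (by simp at hb'; omega)
          simp [D, this]
        · simp [mul_sub, hD z hz m, hD z' hz' m]
      simpa [σ, qJ, hl, D] using sub_eq_zero.1 (congrFun h0 b)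
    · simp [σ, qJ, hl]

lemma prod_norm_le_sum_pow {ι : Type*} {s : Finset ι} (hs : s.Nonempty) (f : ι → ℂ) :
    ∏ j ∈ s, ‖f j‖ ≤ ∑ j ∈ s, ‖f j‖ ^ #s := by
  obtain ⟨x, hx, hmax⟩ := s.exists_max_image (fun j => ‖f j‖) hs
  calc ∏ j ∈ s, ‖f j‖ ≤ ∏ _j ∈ s, ‖f x‖ :=
        Finset.prod_le_prod (fun _ _ => norm_nonneg _) hmax
    _ = ‖f x‖ ^ #s := by simp
    _ ≤ ∑ j ∈ s, ‖f j‖ ^ #s :=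
        Finset.single_le_sum (f := fun j => ‖f j‖ ^ #s) (fun _ _ => by positivity) hx

/-- The index set of the blocks `B_{h,m}`. -/
def blockIdx (t : ℕ) (μ : Fin t → ℕ) : Finset (Σ _ : ℕ, ℕ) :=
  (Finset.Icc 1 t).sigma fun h => Finset.Icc 1 (mu1 t μ h - mu1 t μ (h + 1))

lemma mu1_succ_le {t : ℕ} {μ : Fin t → ℕ} (hμ : StrictAnti μ) {h : ℕ} (hh : 1 ≤ h) :
    mu1 t μ (h + 1) ≤ mu1 t μ h := by
  unfold mu1
  split_ifs with h1 h2
  · exact hμ.antitone (Fin.mk_le_mk.2 (by omega))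
  · omega
  · exact Nat.zero_le _
  · exact le_rfl

lemma sum_Ioc_mu1_sub {t : ℕ} {μ : Fin t → ℕ} (hμ : StrictAnti μ) (l : Fin t) :
    ∑ h ∈ Finset.Ioc (l : ℕ) t, (mu1 t μ h - mu1 t μ (h + 1)) = μ l := by
  have key : ∀ n, (l : ℕ) ≤ n →
      ∑ h ∈ Finset.Ioc (l : ℕ) n, (mu1 t μ h - mu1 t μ (h + 1)) + mu1 t μ (n + 1) = μ l := by
    intro n hn
    induction n, hn using Nat.le_induction with
    | base => simp [mu1]
    | succ n hn ih =>
      rw [Finset.sum_Ioc_succ_top (by omega)]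
      have := mu1_succ_le hμ (h := n + 1) (by omega)
      omega
  simpa [mu1] using key t l.2.le

lemma card_blockIdx_level {t : ℕ} {μ : Fin t → ℕ} (hμ : StrictAnti μ) (l : Fin t) :
    #{b : blockIdx t μ | (l : ℕ) < b.1.1} = μ l := by
  rw [← sum_Ioc_mu1_sub hμ l]
  have : ({b : blockIdx t μ | (l : ℕ) < b.1.1} : Finset _).map (Function.Embedding.subtype _) =
      (Finset.Ioc (l : ℕ) t).sigma fun h => Finset.Icc 1 (mu1 t μ h - mu1 t μ (h + 1)) := by
    ext ⟨h, m⟩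
    have : (⟨h, m⟩ : Σ _ : ℕ, ℕ) ∈ blockIdx t μ ↔
        (1 ≤ h ∧ h ≤ t) ∧ 1 ≤ m ∧ m ≤ mu1 t μ h - mu1 t μ (h + 1) := by simp [blockIdx]
    simp [this]
    omega
  rw [← Finset.card_map, this, Finset.card_sigma]
  simp

/-- Theorem 2.1 of Brandes–Parsell: for a highly non-singular
system, `|I_{𝐮,𝐤,𝛍}(𝒜)| ≪ Π_h (J_{u_h,𝐤_h}(𝒜))^{μ_h - μ_{h+1}}`, uniformly in `P`
and `R`, for `𝒜 = ℤ ∩ [1,P]` or `𝒜 = 𝒜(P,R)` with `2 ≤ R ≤ P`. -/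
theorem statement9
    (t : ℕ) (ν μ : Fin t → ℕ) (k : (l : Fin t) → Fin (ν l) → ℕ)
    (hgrp : GroupedDegrees t ν μ k)
    (s : ℕ) (c : EqIdx t ν μ → Fin s → ℤ)
    (hns : HighlyNonSingular t ν μ s c)
    (u : ℕ → ℕ) (hu : ∀ h ∈ Finset.Icc 1 t, 0 < u h)
    (hs : 2 * ∑ h ∈ Finset.Icc 1 t, (mu1 t μ h - mu1 t μ (h + 1)) * u h ≤ s)
    (B : ℕ × ℕ → Finset (Fin s))
    (hBcard : ∀ h ∈ Finset.Icc 1 t, ∀ m ∈ Finset.Icc 1 (mu1 t μ h - mu1 t μ (h + 1)),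
      (B (h, m)).card = 2 * u h)
    (hBdisj : ∀ h ∈ Finset.Icc 1 t, ∀ m ∈ Finset.Icc 1 (mu1 t μ h - mu1 t μ (h + 1)),
      ∀ h' ∈ Finset.Icc 1 t, ∀ m' ∈ Finset.Icc 1 (mu1 t μ h' - mu1 t μ (h' + 1)),
        (h, m) ≠ (h', m') → Disjoint (B (h, m)) (B (h', m'))) :
    ∃ C : ℝ, ∀ P : ℝ, 1 ≤ P → ∀ A : Finset ℕ,
      (A = completeFS P ∨ ∃ R : ℝ, 2 ≤ R ∧ R ≤ P ∧ A = smoothFS P R) →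
      ‖Iint t ν μ k s c A B‖ ≤
        C * ∏ h ∈ Finset.Icc 1 t, (JA t ν k A (u h) h) ^ (mu1 t μ h - mu1 t μ (h + 1)) := by
  let β := blockIdx t μ
  let B' : β → Finset (Fin s) := fun b => B (b.1.1, b.1.2)
  have hmem : ∀ b : β, b.1.1 ∈ Finset.Icc 1 t ∧
      b.1.2 ∈ Finset.Icc 1 (mu1 t μ b.1.1 - mu1 t μ (b.1.1 + 1)) :=
    fun b => Finset.mem_sigma.1 b.2
  have hcard : ∀ b, #(B' b) = 2 * u b.1.1 := fun b => hBcard _ (hmem b).1 _ (hmem b).2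
  have hne : ∀ b, (B' b).Nonempty := fun b => by
    rw [← Finset.card_pos, hcard b]
    have := hu _ (hmem b).1
    omega
  have hinj : ∀ p ∈ Fintype.piFinset B', Function.Injective p := by
    intro p hp b b' hbb
    by_contra hne'
    rw [Fintype.mem_piFinset] at hp
    refine Finset.disjoint_left.1 (hBdisj _ (hmem b).1 _ (hmem b).2 _ (hmem b').1 _ (hmem b').2
      fun h => hne' ?_) (hp b) (hbb ▸ hp b')
    rw [Prod.mk.injEq] at h
    exact Subtype.ext (Sigma.ext h.1 (heq_of_eq h.2))
  refine ⟨#(Fintype.piFinset B'), fun P _ A _ => ?_⟩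
  have hint : ∀ p : β → Fin s, IntegrableOn
      (fun α => ∏ b : β, ‖fj t ν μ k s c A α (p b)‖ ^ (2 * u b.1.1)) (unitBox (EqIdx t ν μ)) :=
    fun p => integrableOn_unitBox <| continuous_finsetProd _ fun b _ =>
      ((continuous_fj t ν μ k s c A (p b)).norm).pow _
  have hbound : ∀ α, ‖∏ h ∈ Finset.Icc 1 t, ∏ m ∈ Finset.Icc 1 (mu1 t μ h - mu1 t μ (h + 1)),
      ∏ j ∈ B (h, m), fj t ν μ k s c A α j‖ ≤
      ∑ p ∈ Fintype.piFinset B', ∏ b : β, ‖fj t ν μ k s c A α (p b)‖ ^ (2 * u b.1.1) := by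
    intro α
    rw [Finset.prod_sigma', ← Finset.prod_univ_sum B' fun b j =>
      ‖fj t ν μ k s c A α j‖ ^ (2 * u b.1.1)]
    rw [← Finset.prod_coe_sort, norm_prod]
    refine Finset.prod_le_prod (fun _ _ => norm_nonneg _) fun b _ => ?_
    rw [norm_prod, ← hcard b]
    exact prod_norm_le_sum_pow (hne b) _
  have hJ : ∏ h ∈ Finset.Icc 1 t, JA t ν k A (u h) h ^ (mu1 t μ h - mu1 t μ (h + 1)) =
      ∏ b : β, JA t ν k A (u b.1.1) b.1.1 := by
    rw [Finset.prod_coe_sort (blockIdx t μ) fun b => JA t ν k A (u b.1) b.1, blockIdx,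
      Finset.prod_sigma]
    simp
  calc ‖Iint t ν μ k s c A B‖
      ≤ ∫ α in unitBox (EqIdx t ν μ), ∑ p ∈ Fintype.piFinset B',
          ∏ b : β, ‖fj t ν μ k s c A α (p b)‖ ^ (2 * u b.1.1) :=
        norm_integral_le_of_norm_le (integrable_finsetSum _ fun p _ => hint p)
          (Eventually.of_forall hbound)
    _ = ∑ p ∈ Fintype.piFinset B', ∫ α in unitBox (EqIdx t ν μ),
          ∏ b : β, ‖fj t ν μ k s c A α (p b)‖ ^ (2 * u b.1.1) :=
        integral_finsetSum _ fun p _ => hint p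
    _ ≤ ∑ p ∈ Fintype.piFinset B', ∏ b : β, JA t ν k A (u b.1.1) b.1.1 :=
        Finset.sum_le_sum fun p hp => integral_prod_norm_fj_le k hns (fun b : β => b.1.1)
          (fun b => u b.1.1) (hinj p hp) (card_blockIdx_level hgrp.2.2.2.1) A
    _ = _ := by rw [hJ, Finset.sum_const, nsmul_eq_mul]

end
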